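/- Assume 2 < sp < p, δ > 0, and that Kⁿ is nonempty. Suppose u₁, u₂ ∈ Kⁿ both solve the variational inequality: a_{p,δ}(u_i, v − u_i) − ∫_{Ω_n} f (v − u_i) dx ≥ 0 for every v ∈ Kⁿ (i = 1,2). Then E_{s,p}(u₁ − u₂) = 0 and ∫_{∂Ω_n} b |u₁ − u₂|^p dℓ = 0. In particular, u₁ − u₂ equals a constant almost everywhere on Ω_n with respect to Lebesgue measure, and u₁ = u₂ ℓ-almost everywhere on ∂Ω_n. -/

import Mathlib

open MeasureTheory Set
open scoped ENNReal

noncomputable section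

/-- The Gagliardo energy `E_{s,p}(v) = ∬_{Ω_n×Ω_n} |v(x)−v(y)|^p / |x−y|^{2+sp} dx dy`. -/
def gagliardoEnergy (Ω : Set (EuclideanSpace ℝ (Fin 2))) (s p : ℝ)
    (v : EuclideanSpace ℝ (Fin 2) → ℝ) : ℝ≥0∞ :=
  ∫⁻ x in Ω, ∫⁻ y in Ω, ENNReal.ofReal (|v x - v y| ^ p / ‖x - y‖ ^ (2 + s * p))

/-- The boundary term `∫_{∂Ω_n} b |v|^p dℓ ∈ [0,∞]`. -/
def boundaryTerm (ℓm : Measure (EuclideanSpace ℝ (Fin 2))) (b : EuclideanSpace ℝ (Fin 2) → ℝ)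
    (p : ℝ) (v : EuclideanSpace ℝ (Fin 2) → ℝ) : ℝ≥0∞ :=
  ∫⁻ x, ENNReal.ofReal (b x * |v x| ^ p) ∂ℓm

/-- The admissible convex set `Kⁿ`. -/
def memKn (Ω : Set (EuclideanSpace ℝ (Fin 2))) (ℓm : Measure (EuclideanSpace ℝ (Fin 2)))
    (s p : ℝ) (f b φ₁ φ₂ v : EuclideanSpace ℝ (Fin 2) → ℝ) : Prop :=
  Measurable v ∧
  (∀ᵐ x ∂(volume.restrict Ω), φ₁ x ≤ v x ∧ v x ≤ φ₂ x) ∧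
  MemLp v (ENNReal.ofReal p) (volume.restrict Ω) ∧
  Integrable (fun x => f x * v x) (volume.restrict Ω) ∧
  gagliardoEnergy Ω s p v < ∞ ∧
  boundaryTerm ℓm b p v < ∞

/-- The form
`a_{p,δ}(u,v) = ∬_{Ω_n×Ω_n} |u(x)−u(y)|^{p−2}(u(x)−u(y))(v(x)−v(y))/|x−y|^{2+sp} dx dy
  + δ ∫_{∂Ω_n} b |u|^{p−2} u v dℓ`. -/
def apδForm (Ω : Set (EuclideanSpace ℝ (Fin 2))) (ℓm : Measure (EuclideanSpace ℝ (Fin 2)))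
    (s p δ : ℝ) (b u v : EuclideanSpace ℝ (Fin 2) → ℝ) : ℝ :=
  (∫ x in Ω, ∫ y in Ω,
      |u x - u y| ^ (p - 2) * (u x - u y) * (v x - v y) / ‖x - y‖ ^ (2 + s * p)) +
    δ * ∫ x, b x * |u x| ^ (p - 2) * u x * v x ∂ℓm

lemma strictMono_abs_rpow_mul_self {q : ℝ} (hq : 0 ≤ q) :
    StrictMono fun t : ℝ => |t| ^ q * t := by
  refine strictMono_of_odd_strictMonoOn_nonneg (fun t => by simp) ?_
  intro a ha b hb hab
  have ha' : 0 ≤ a := ha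
  have hb' : 0 < b := ha'.trans_lt hab
  simp only [abs_of_nonneg ha', abs_of_pos hb']
  exact mul_lt_mul' (Real.rpow_le_rpow ha' hab.le hq) hab ha' (Real.rpow_pos_of_pos hb' q)

lemma abs_rpow_sub_two_mul_le {p : ℝ} (hp : 2 < p) (a b : ℝ) :
    |(|a| ^ (p - 2) * a * b)| ≤ |a| ^ p + |b| ^ p := by
  have key : ∀ m : ℝ, 0 ≤ m → m ^ (p - 2) * m * m = m ^ p := by
    intro m hm
    rw [mul_assoc, ← sq, ← Real.rpow_natCast, ← Real.rpow_add_of_nonneg hm (by linarith) (by simp)]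
    norm_num
  rw [abs_mul, abs_mul, abs_of_nonneg (Real.rpow_nonneg (abs_nonneg a) _)]
  have hmax : |a| ^ (p - 2) * |a| * |b| ≤ max |a| |b| ^ p := by
    rw [← key _ (le_max_of_le_left (abs_nonneg a))]
    have := Real.rpow_le_rpow (abs_nonneg a) (le_max_left |a| |b|) (by linarith : 0 ≤ p - 2)
    gcongr
    · exact le_max_left _ _
    · exact le_max_right _ _
  refine hmax.trans ?_
  have h₁ := Real.rpow_nonneg (abs_nonneg a) p
  have h₂ := Real.rpow_nonneg (abs_nonneg b) p
  rcases max_choice |a| |b| with h | h <;> rw [h] <;> linarith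

section Weighted

variable {α : Type*} [MeasurableSpace α] {μ : Measure α} {p : ℝ} {w A B : α → ℝ}

lemma integrable_weight_mul_abs_rpow (hw : Measurable w) (hw0 : ∀ᵐ x ∂μ, 0 ≤ w x)
    (hA : Measurable A) (hfin : ∫⁻ x, ENNReal.ofReal (w x * |A x| ^ p) ∂μ < ∞) :
    Integrable (fun x => w x * |A x| ^ p) μ := by
  refine (lintegral_ofReal_ne_top_iff_integrable
    (Measurable.aestronglyMeasurable (by fun_prop)) ?_).1 hfin.ne
  filter_upwards [hw0] with x hx
  exact mul_nonneg hx (Real.rpow_nonneg (abs_nonneg _) _)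

lemma integrable_weight_mul_duality (hp : 2 < p) (hw : Measurable w) (hw0 : ∀ᵐ x ∂μ, 0 ≤ w x)
    (hA : Measurable A) (hB : Measurable B)
    (hiA : Integrable (fun x => w x * |A x| ^ p) μ)
    (hiB : Integrable (fun x => w x * |B x| ^ p) μ) :
    Integrable (fun x => w x * (|A x| ^ (p - 2) * A x * B x)) μ := by
  refine (hiA.add hiB).mono' (Measurable.aestronglyMeasurable (by fun_prop)) ?_
  filter_upwards [hw0] with x hx
  rw [Real.norm_eq_abs, abs_mul, abs_of_nonneg hx, Pi.add_apply, ← mul_add]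
  exact mul_le_mul_of_nonneg_left (abs_rpow_sub_two_mul_le hp _ _) hx

/-- Monotonicity of the weighted duality map `A ↦ w |A|^{p-2} A` in integrated form. -/
lemma weighted_duality_sum_nonpos (hp : 2 < p) (hw : Measurable w) (hw0 : ∀ᵐ x ∂μ, 0 ≤ w x)
    (hA : Measurable A) (hB : Measurable B)
    (hfA : ∫⁻ x, ENNReal.ofReal (w x * |A x| ^ p) ∂μ < ∞)
    (hfB : ∫⁻ x, ENNReal.ofReal (w x * |B x| ^ p) ∂μ < ∞) :
    Integrable (fun x => w x * (|A x| ^ (p - 2) * A x * (B x - A x))) μ ∧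
    Integrable (fun x => w x * (|B x| ^ (p - 2) * B x * (A x - B x))) μ ∧
    (∫ x, w x * (|A x| ^ (p - 2) * A x * (B x - A x)) ∂μ) +
      (∫ x, w x * (|B x| ^ (p - 2) * B x * (A x - B x)) ∂μ) ≤ 0 ∧
    (0 ≤ (∫ x, w x * (|A x| ^ (p - 2) * A x * (B x - A x)) ∂μ) +
        (∫ x, w x * (|B x| ^ (p - 2) * B x * (A x - B x)) ∂μ) →
      ∀ᵐ x ∂μ, w x = 0 ∨ A x = B x) := by
  have hiA := integrable_weight_mul_abs_rpow hw hw0 hA hfA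
  have hiB := integrable_weight_mul_abs_rpow hw hw0 hB hfB
  have h₁ : Integrable (fun x => w x * (|A x| ^ (p - 2) * A x * (B x - A x))) μ := by
    simpa only [mul_sub, Pi.sub_def] using
      (integrable_weight_mul_duality hp hw hw0 hA hB hiA hiB).sub
      (integrable_weight_mul_duality hp hw hw0 hA hA hiA hiA)
  have h₂ : Integrable (fun x => w x * (|B x| ^ (p - 2) * B x * (A x - B x))) μ := by
    simpa only [mul_sub, Pi.sub_def] using
      (integrable_weight_mul_duality hp hw hw0 hB hA hiB hiA).sub
      (integrable_weight_mul_duality hp hw hw0 hB hB hiB hiB)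
  have hmono := strictMono_abs_rpow_mul_self (q := p - 2) (by linarith)
  have hpos : ∀ a b : ℝ, a ≠ b →
      0 < (|a| ^ (p - 2) * a - |b| ^ (p - 2) * b) * (a - b) := by
    intro a b hab
    rcases hab.lt_or_gt with h | h
    · exact mul_pos_of_neg_of_neg (sub_neg.2 (hmono h)) (sub_neg.2 h)
    · exact mul_pos (sub_pos.2 (hmono h)) (sub_pos.2 h)
  set D : α → ℝ := fun x =>
    w x * ((|A x| ^ (p - 2) * A x - |B x| ^ (p - 2) * B x) * (A x - B x)) with hD
  have hsum : (fun x => w x * (|A x| ^ (p - 2) * A x * (B x - A x)) +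
      w x * (|B x| ^ (p - 2) * B x * (A x - B x))) = fun x => -D x := by
    funext x; simp only [hD]; ring
  have hDint : Integrable D μ := by
    have h := (h₁.add h₂).neg
    rw [Pi.add_def, hsum] at h
    simpa [Pi.neg_def] using h
  have hD0 : 0 ≤ᵐ[μ] D := by
    filter_upwards [hw0] with x hx
    refine mul_nonneg hx ?_
    by_cases h : A x = B x
    · simp [h]
    · exact (hpos _ _ h).le
  rw [← integral_add h₁ h₂, hsum, integral_neg]
  refine ⟨h₁, h₂, neg_nonpos.2 (integral_nonneg_of_ae hD0), fun h => ?_⟩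
  have hzero := (integral_eq_zero_iff_of_nonneg_ae hD0 hDint).1
    (le_antisymm (neg_nonneg.1 h) (integral_nonneg_of_ae hD0))
  filter_upwards [hzero] with x hx
  rcases mul_eq_zero.1 hx with h | h
  · exact Or.inl h
  · exact Or.inr (by_contra fun hne => (hpos _ _ hne).ne' h)

end Weighted

/-- **Theorem 2.7 (uniqueness, pre-fractal case)**: for `2 < sp < p`, `δ > 0` and `Kⁿ ≠ ∅`,
if `u₁, u₂ ∈ Kⁿ` both solve the variational inequality then `E_{s,p}(u₁−u₂) = 0` and
`∫_{∂Ω_n} b |u₁−u₂|^p dℓ = 0`; in particular `u₁ − u₂` is a.e. constant on `Ω_n` and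
`u₁ = u₂` `ℓ`-a.e. on `∂Ω_n`. -/
theorem stmt9 (Ωn : Set (EuclideanSpace ℝ (Fin 2))) (hne : Ωn.Nonempty) (hop : IsOpen Ωn)
    (hbd : Bornology.IsBounded Ωn)
    (s p : ℝ) (hs : s ∈ Ioo (0:ℝ) 1) (hp : 1 < p) (h2sp : 2 < s * p) (hspp : s * p < p)
    (δ : ℝ) (hδ : 0 < δ)
    (f b φ₁ φ₂ : EuclideanSpace ℝ (Fin 2) → ℝ)
    (hf : Integrable f (volume.restrict Ωn))
    (hbcont : Continuous b) (hbpos : ∀ x ∈ closure Ωn, 0 < b x)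
    (hφ₁ : Measurable φ₁) (hφ₂ : Measurable φ₂)
    (hφ : ∀ᵐ x ∂(volume.restrict Ωn), φ₁ x ≤ φ₂ x)
    (ℓm : Measure (EuclideanSpace ℝ (Fin 2)))
    (hℓm : ℓm = (μH[(1:ℝ)]).restrict (frontier Ωn))
    (hKne : ∃ v, memKn Ωn ℓm s p f b φ₁ φ₂ v)
    (u₁ u₂ : EuclideanSpace ℝ (Fin 2) → ℝ)
    (hu₁ : memKn Ωn ℓm s p f b φ₁ φ₂ u₁) (hu₂ : memKn Ωn ℓm s p f b φ₁ φ₂ u₂)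
    (hVI₁ : ∀ v, memKn Ωn ℓm s p f b φ₁ φ₂ v →
      0 ≤ apδForm Ωn ℓm s p δ b u₁ (fun x => v x - u₁ x) - ∫ x in Ωn, f x * (v x - u₁ x))
    (hVI₂ : ∀ v, memKn Ωn ℓm s p f b φ₁ φ₂ v →
      0 ≤ apδForm Ωn ℓm s p δ b u₂ (fun x => v x - u₂ x) - ∫ x in Ωn, f x * (v x - u₂ x)) :
    gagliardoEnergy Ωn s p (fun x => u₁ x - u₂ x) = 0 ∧
    boundaryTerm ℓm b p (fun x => u₁ x - u₂ x) = 0 ∧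
    (∃ c : ℝ, ∀ᵐ x ∂(volume.restrict Ωn), u₁ x - u₂ x = c) ∧
    (∀ᵐ x ∂ℓm, u₁ x = u₂ x) := by
  have hp2 : 2 < p := h2sp.trans hspp
  have hp0 : p ≠ 0 := by linarith
  have hm₁ : Measurable u₁ := hu₁.1
  have hm₂ : Measurable u₂ := hu₂.1
  set ν : Measure (EuclideanSpace ℝ (Fin 2)) := volume.restrict Ωn with hν
  have hbℓ : ∀ᵐ x ∂ℓm, 0 < b x := by
    rw [hℓm]
    filter_upwards [ae_restrict_mem isClosed_frontier.measurableSet] with x hx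
    exact hbpos x (frontier_subset_closure hx)
  obtain ⟨-, -, hbd_le, hbd_eq⟩ := weighted_duality_sum_nonpos hp2 hbcont.measurable
    (hbℓ.mono fun _ h => h.le) hm₁ hm₂ hu₁.2.2.2.2.2 hu₂.2.2.2.2.2
  set w : EuclideanSpace ℝ (Fin 2) × EuclideanSpace ℝ (Fin 2) → ℝ :=
    fun z => (‖z.1 - z.2‖ ^ (2 + s * p))⁻¹ with hw
  have hwm : Measurable w := by fun_prop
  have hw0 : ∀ z, 0 ≤ w z := fun z => inv_nonneg.2 (Real.rpow_nonneg (norm_nonneg _) _)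
  have henergy : ∀ u : EuclideanSpace ℝ (Fin 2) → ℝ, Measurable u →
      gagliardoEnergy Ωn s p u < ∞ →
      ∫⁻ z, ENNReal.ofReal (w z * |u z.1 - u z.2| ^ p) ∂(ν.prod ν) < ∞ := by
    intro u hu h
    rw [lintegral_prod _ (by fun_prop)]
    simpa only [gagliardoEnergy, hw, div_eq_inv_mul] using h
  obtain ⟨hint₁, hint₂, hgag_le, hgag_eq⟩ := weighted_duality_sum_nonpos
    (A := fun z : EuclideanSpace ℝ (Fin 2) × EuclideanSpace ℝ (Fin 2) => u₁ z.1 - u₁ z.2)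
    (B := fun z : EuclideanSpace ℝ (Fin 2) × EuclideanSpace ℝ (Fin 2) => u₂ z.1 - u₂ z.2)
    hp2 hwm (ae_of_all (ν.prod ν) hw0) (by fun_prop) (by fun_prop)
    (henergy u₁ hm₁ hu₁.2.2.2.2.1) (henergy u₂ hm₂ hu₂.2.2.2.2.1)
  have hform : ∀ u v : EuclideanSpace ℝ (Fin 2) → ℝ,
      Integrable (fun z => w z * (|u z.1 - u z.2| ^ (p - 2) * (u z.1 - u z.2) *
        ((v z.1 - v z.2) - (u z.1 - u z.2)))) (ν.prod ν) →
      apδForm Ωn ℓm s p δ b u (fun x => v x - u x) =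
        (∫ z, w z * (|u z.1 - u z.2| ^ (p - 2) * (u z.1 - u z.2) *
          ((v z.1 - v z.2) - (u z.1 - u z.2))) ∂(ν.prod ν)) +
        δ * ∫ x, b x * (|u x| ^ (p - 2) * u x * (v x - u x)) ∂ℓm := by
    intro u v hi
    rw [integral_prod _ hi, apδForm]
    congr 3
    · funext x
      congr 1
      funext y
      simp only [hw]
      ring
    · simp only [mul_assoc]
  have hV₁ := hVI₁ u₂ hu₂
  have hV₂ := hVI₂ u₁ hu₁
  rw [hform u₁ u₂ hint₁] at hV₁
  rw [hform u₂ u₁ hint₂] at hV₂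
  have hfneg : ∫ x in Ωn, f x * (u₂ x - u₁ x) = -∫ x in Ωn, f x * (u₁ x - u₂ x) := by
    rw [← integral_neg]
    congr 1
    funext x
    ring
  rw [hfneg] at hV₁
  have hbd_le' := mul_nonpos_of_nonneg_of_nonpos hδ.le hbd_le
  rw [mul_add] at hbd_le'
  have hgag := hgag_eq (by linarith)
  have hbdry := hbd_eq (nonneg_of_mul_nonneg_right (by rw [mul_add]; linarith) hδ)
  have hbu : ∀ᵐ x ∂ℓm, u₁ x = u₂ x := by
    filter_upwards [hbdry, hbℓ] with x hx hb
    exact hx.resolve_left hb.ne'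
  have hdiff : ∀ᵐ x ∂ν, ∀ᵐ y ∂ν, u₁ x - u₂ x = u₁ y - u₂ y := by
    filter_upwards [Measure.ae_ae_of_ae_prod hgag] with x hx
    filter_upwards [hx] with y hy
    rcases hy with h | h
    · have hxy : x = y := by
        have h' := (Real.rpow_eq_zero (norm_nonneg _) (by linarith)).1 (inv_eq_zero.1 h)
        exact sub_eq_zero.1 (norm_eq_zero.1 h')
      rw [hxy]
    · linarith [h]
  refine ⟨?_, ?_, ?_, hbu⟩
  · rw [gagliardoEnergy, ← hν, ← lintegral_zero (μ := ν)]
    refine lintegral_congr_ae ?_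
    filter_upwards [hdiff] with x hx
    rw [← lintegral_zero (μ := ν)]
    refine lintegral_congr_ae ?_
    filter_upwards [hx] with y hy
    simp [hy, Real.zero_rpow hp0]
  · rw [boundaryTerm, ← lintegral_zero (μ := ℓm)]
    refine lintegral_congr_ae ?_
    filter_upwards [hbu] with x hx
    simp [hx, Real.zero_rpow hp0]
  · have hν0 : ν ≠ 0 := by
      rw [hν, Ne, Measure.restrict_eq_zero]
      exact (hop.measure_pos volume hne).ne'
    have : (ae ν).NeBot := ae_neBot.2 hν0
    obtain ⟨x, hx⟩ := hdiff.exists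
    exact ⟨u₁ x - u₂ x, hx.mono fun y hy => hy.symm⟩
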